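/- arXiv:2405.20618 — 4 statements merged into one kernel-verified Lean document; each statement's English description precedes it below -/
import Mathlib

section
/- Let G be a simple graph on a finite vertex set V with injective labeling id : V → ℕ, and run the deterministic MIS iteration A₀ = ∅, P₀ = V, A_{k+1} = A_k ∪ T(P_k), P_{k+1} = P_k \ (T(P_k) ∪ N(T(P_k))). Then for every k ≥ 0, the accepted set A_k is an independent set of G and no vertex of P_k is adjacent to any vertex of A_k. -/
variable {V : Type*} [Fintype V] [DecidableEq V]

/-- The locally minimal set `T(P) = {v ∈ P : id v ≤ id u for all u ∈ N(v) ∩ P}`. -/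
def misT (G : SimpleGraph V) [DecidableRel G.Adj] (id : V → ℕ) (P : Finset V) :
    Finset V :=
  P.filter fun v => ∀ u ∈ P, G.Adj v u → id v ≤ id u

/-- The neighborhood `N(S) = ⋃_{v∈S} N(v)` of a set of vertices. -/
def misN (G : SimpleGraph V) [DecidableRel G.Adj] (S : Finset V) : Finset V :=
  S.biUnion fun v => G.neighborFinset v

/-- The deterministic MIS iteration: `A₀ = ∅`, `P₀ = V`,
`A_{k+1} = A_k ∪ T(P_k)`, `P_{k+1} = P_k \ (T(P_k) ∪ N(T(P_k)))`. -/
def misIter (G : SimpleGraph V) [DecidableRel G.Adj] (id : V → ℕ) :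
    ℕ → Finset V × Finset V
  | 0 => (∅, Finset.univ)
  | k + 1 =>
    let AP := misIter G id k
    (AP.1 ∪ misT G id AP.2, AP.2 \ (misT G id AP.2 ∪ misN G (misT G id AP.2)))

lemma not_adj_of_mem_misT (G : SimpleGraph V) [DecidableRel G.Adj] {id : V → ℕ}
    (hid : Function.Injective id) {P : Finset V} {v w : V}
    (hv : v ∈ misT G id P) (hw : w ∈ misT G id P) : ¬ G.Adj v w := by
  intro h
  simp only [misT, Finset.mem_filter] at hv hw
  exact h.ne (hid (le_antisymm (hv.2 w hw.1 h) (hw.2 v hv.1 h.symm)))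

/-- For every `k`, the accepted set `A_k` is independent, and no vertex of the
pending set `P_k` is adjacent to any vertex of `A_k`. -/
theorem misIter_accepted_independent_and_pending_nonadjacent
    (G : SimpleGraph V) [DecidableRel G.Adj] (id : V → ℕ)
    (hid : Function.Injective id) (k : ℕ) :
    (∀ v ∈ (misIter G id k).1, ∀ w ∈ (misIter G id k).1, ¬ G.Adj v w) ∧
      (∀ v ∈ (misIter G id k).2, ∀ w ∈ (misIter G id k).1, ¬ G.Adj v w) := by
  induction k with
  | zero => simp [misIter]
  | succ k ih =>
    obtain ⟨hA, hP⟩ := ih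
    have hT : ∀ v ∈ misT G id (misIter G id k).2, v ∈ (misIter G id k).2 :=
      fun v hv => Finset.mem_of_mem_filter v hv
    simp only [misIter, Finset.mem_union, Finset.mem_sdiff, not_or]
    refine ⟨?_, ?_⟩
    · rintro v (hv | hv) w (hw | hw)
      · exact hA v hv w hw
      · exact fun h => hP w (hT w hw) v hv h.symm
      · exact hP v (hT v hv) w hw
      · exact not_adj_of_mem_misT G hid hv hw
    · rintro v ⟨hv, -, hvN⟩ w (hw | hw) h
      · exact hP v hv w hw h
      · refine hvN (Finset.mem_biUnion.2 ⟨w, hw, ?_⟩)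
        simpa using h.symm
end

section
/- (Lemma 1 of the paper.) Let G be a simple graph on a finite nonempty vertex set V with injective labeling id : V → ℕ, and run the deterministic MIS iteration A₀ = ∅, P₀ = V, A_{k+1} = A_k ∪ T(P_k), P_{k+1} = P_k \ (T(P_k) ∪ N(T(P_k))). Then for every k ≥ 1, A_k is a nonempty independent set of G; moreover the vertex of V with globally minimal label id belongs to A_k for all k ≥ 1. -/
variable {V : Type*} [Fintype V] [DecidableEq V]

section

variable (G : SimpleGraph V) [DecidableRel G.Adj] (id : V → ℕ)

theorem mem_misT {P : Finset V} {v : V} :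
    v ∈ misT G id P ↔ v ∈ P ∧ ∀ u ∈ P, G.Adj v u → id v ≤ id u := by
  simp [misT]

theorem mem_misN {S : Finset V} {v : V} : v ∈ misN G S ↔ ∃ u ∈ S, G.Adj u v := by
  simp [misN]

theorem misT_independent (hid : Function.Injective id) {P : Finset V} {v w : V}
    (hv : v ∈ misT G id P) (hw : w ∈ misT G id P) : ¬ G.Adj v w := by
  rw [mem_misT] at hv hw
  intro h
  exact h.ne (hid (le_antisymm (hv.2 w hw.1 h) (hw.2 v hv.1 h.symm)))

/-- Accepted vertices are independent and have no neighbor among the remaining ones. -/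
theorem misIter_independent (hid : Function.Injective id) (k : ℕ) :
    (∀ v ∈ (misIter G id k).1, ∀ w ∈ (misIter G id k).1, ¬ G.Adj v w) ∧
      ∀ v ∈ (misIter G id k).1, ∀ w ∈ (misIter G id k).2, ¬ G.Adj v w := by
  induction k with
  | zero => simp [misIter]
  | succ k ih =>
    obtain ⟨hA, hP⟩ := ih
    have hT : ∀ v ∈ misT G id (misIter G id k).2, v ∈ (misIter G id k).2 :=
      fun v hv => ((mem_misT G id).1 hv).1
    simp only [misIter, Finset.mem_union, Finset.mem_sdiff, mem_misN, not_or, not_exists, not_and]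
    refine ⟨?_, ?_⟩
    · rintro v (hv | hv) w (hw | hw)
      · exact hA v hv w hw
      · exact hP v hv w (hT w hw)
      · exact fun h => hP w hw v (hT v hv) h.symm
      · exact misT_independent G id hid hv hw
    · rintro v (hv | hv) w ⟨hw, -, hN⟩
      · exact hP v hv w hw
      · exact hN v hv

theorem mem_misIter_succ_of_forall_le {v : V} (hv : ∀ u, id v ≤ id u) (k : ℕ) :
    v ∈ (misIter G id (k + 1)).1 := by
  induction k with
  | zero => simp [misIter, mem_misT, hv]
  | succ k ih => exact Finset.mem_union_left _ ih

end

/-- Lemma 1 of the paper: for every `k ≥ 1`, `A_k` is a nonempty independent set,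
and the vertex of `V` with globally minimal label belongs to `A_k`. -/
theorem misIter_accepted_nonempty_independent
    (G : SimpleGraph V) [DecidableRel G.Adj] [Nonempty V] (id : V → ℕ)
    (hid : Function.Injective id) (k : ℕ) (hk : 1 ≤ k) :
    (misIter G id k).1.Nonempty ∧
      (∀ v ∈ (misIter G id k).1, ∀ w ∈ (misIter G id k).1, ¬ G.Adj v w) ∧
      (∀ v : V, (∀ u : V, id v ≤ id u) → v ∈ (misIter G id k).1) := by
  have hmin : ∀ v : V, (∀ u : V, id v ≤ id u) → v ∈ (misIter G id k).1 := by
    obtain ⟨j, rfl⟩ := Nat.exists_eq_add_of_le' hk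
    exact fun v hv => mem_misIter_succ_of_forall_le G id hv j
  obtain ⟨v, hv⟩ := Finite.exists_min id
  exact ⟨⟨v, hmin v hv⟩, (misIter_independent G id hid k).1, hmin⟩
end

section
/- (One-round consistency underlying Theorem 1.) Let G be a simple graph on a finite vertex set V with injective labeling id : V → ℕ, let P ⊆ V, and let P = P₁ ∪ … ∪ Pₙ be a partition of P into pairwise disjoint subsets. Suppose for each i there is an extended set P_i^δ with P_i ⊆ P_i^δ ⊆ P such that N(v) ∩ P ⊆ P_i^δ for every v ∈ P_i. Then the union over i of the locally selected sets {v ∈ P_i : id v ≤ id u for every u ∈ N(v) ∩ P_i^δ} equals the global locally minimal set T(P) = {v ∈ P : id v ≤ id u for every u ∈ N(v) ∩ P}. -/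
/-- One-round consistency: if `P = P₁ ∪ … ∪ Pₙ` is a partition and each part has
an extended set `P_i^δ` with `P_i ⊆ P_i^δ ⊆ P` containing all neighbors in `P`
of vertices of `P_i`, then the union of the local selections equals the global
locally minimal set `T(P)`. -/
theorem local_selection_union_eq_global
    {V : Type*} [Fintype V] [DecidableEq V]
    (G : SimpleGraph V) [DecidableRel G.Adj] (id : V → ℕ)
    (hid : Function.Injective id) (P : Finset V) (n : ℕ)
    (parts ext : Fin n → Finset V)
    (hdisj : ∀ i j, i ≠ j → Disjoint (parts i) (parts j))
    (hunion : Finset.univ.biUnion parts = P)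
    (hsub : ∀ i, parts i ⊆ ext i)
    (hsub' : ∀ i, ext i ⊆ P)
    (hnbr : ∀ i, ∀ v ∈ parts i, ∀ u ∈ P, G.Adj v u → u ∈ ext i) :
    Finset.univ.biUnion
        (fun i => (parts i).filter fun v => ∀ u ∈ ext i, G.Adj v u → id v ≤ id u)
      = P.filter fun v => ∀ u ∈ P, G.Adj v u → id v ≤ id u := by
  subst hunion
  ext v
  simp only [Finset.mem_biUnion, Finset.mem_filter, Finset.mem_univ, true_and]
  constructor
  · rintro ⟨i, hv, hmin⟩
    exact ⟨⟨i, hv⟩, fun u ⟨j, hu⟩ huv =>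
      hmin u (hnbr i v hv u (Finset.mem_biUnion.2 ⟨j, Finset.mem_univ j, hu⟩) huv) huv⟩
  · rintro ⟨⟨i, hv⟩, hmin⟩
    refine ⟨i, hv, fun u hu huv => hmin u ?_ huv⟩
    simpa using hsub' i hu
end

section
/- (Theorem 1 of the paper: parallel consistency.) Let G be a simple graph on a finite vertex set V with injective labeling id : V → ℕ. Run the sequential MIS iteration A₀ = ∅, P₀ = V, A_{k+1} = A_k ∪ T(P_k), P_{k+1} = P_k \ (T(P_k) ∪ N(T(P_k))). Separately, run a distributed iteration in which at each round k the pending set Q_k is partitioned into pairwise disjoint parts Q_{k,1}, …, Q_{k,n_k} with extended sets Q_{k,i}^δ satisfying Q_{k,i} ⊆ Q_{k,i}^δ ⊆ Q_k and N(v) ∩ Q_k ⊆ Q_{k,i}^δ for all v ∈ Q_{k,i}, the local selections are T_{k,i} = {v ∈ Q_{k,i} : id v ≤ id u for all u ∈ N(v) ∩ Q_{k,i}^δ}, and the state is updated by B_{k+1} = B_k ∪ ⋃_i T_{k,i}, Q_{k+1} = Q_k \ ⋃_i (T_{k,i} ∪ N(T_{k,i})), starting from B₀ = ∅, Q₀ =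 V. Then for every k, B_k = A_k and Q_k = P_k; in particular the independent set produced is independent of the partitions and of the number of parts. -/
variable {V : Type*} [Fintype V] [DecidableEq V]

theorem biUnion_filter_eq_misT (G : SimpleGraph V) [DecidableRel G.Adj] (id : V → ℕ)
    {ι : Type*} [Fintype ι] {parts ext : ι → Finset V} {Q : Finset V}
    (hunion : Finset.univ.biUnion parts = Q) (hsub : ∀ i, ext i ⊆ Q)
    (hnbr : ∀ i, ∀ v ∈ parts i, ∀ u ∈ Q, G.Adj v u → u ∈ ext i) :
    (Finset.univ.biUnion fun i =>
      (parts i).filter fun v => ∀ u ∈ ext i, G.Adj v u → id v ≤ id u) = misT G id Q := by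
  subst hunion
  ext v
  simp only [misT, Finset.mem_biUnion, Finset.mem_filter, Finset.mem_univ, true_and]
  constructor
  · rintro ⟨i, hv, hmin⟩
    exact ⟨⟨i, hv⟩, fun u hu huv =>
      hmin u (hnbr i v hv u (by simpa using hu) huv) huv⟩
  · rintro ⟨⟨i, hv⟩, hmin⟩
    exact ⟨i, hv, fun u hu huv => hmin u (by simpa using hsub i hu) huv⟩

theorem biUnion_union_misN (G : SimpleGraph V) [DecidableRel G.Adj]
    {ι : Type*} [Fintype ι] (S : ι → Finset V) :
    (Finset.univ.biUnion fun i => S i ∪ misN G (S i)) =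
      Finset.univ.biUnion S ∪ misN G (Finset.univ.biUnion S) := by
  ext v
  simp only [misN, Finset.mem_biUnion, Finset.mem_union, Finset.mem_univ, true_and]
  grind

/-- Theorem 1 of the paper (parallel consistency): any distributed MIS iteration,
where at each round the pending set is partitioned into disjoint parts with
sufficiently large extended (overlapping) sets, produces exactly the same
accepted and pending sets as the sequential deterministic MIS iteration.
In particular the independent set produced is independent of the partitions
and of the number of parts. -/
theorem distributed_misIter_consistent
    (G : SimpleGraph V) [DecidableRel G.Adj] (id : V → ℕ)
    (hid : Function.Injective id)
    (n : ℕ → ℕ) (parts ext : (k : ℕ) → Fin (n k) → Finset V)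
    (B Q : ℕ → Finset V)
    (hB0 : B 0 = ∅) (hQ0 : Q 0 = Finset.univ)
    (hdisj : ∀ k, ∀ i j, i ≠ j → Disjoint (parts k i) (parts k j))
    (hunion : ∀ k, Finset.univ.biUnion (parts k) = Q k)
    (hsub : ∀ k i, parts k i ⊆ ext k i)
    (hsub' : ∀ k i, ext k i ⊆ Q k)
    (hnbr : ∀ k i, ∀ v ∈ parts k i, ∀ u ∈ Q k, G.Adj v u → u ∈ ext k i)
    (hBsucc : ∀ k, B (k + 1) = B k ∪ Finset.univ.biUnion
        (fun i => (parts k i).filter fun v => ∀ u ∈ ext k i, G.Adj v u → id v ≤ id u))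
    (hQsucc : ∀ k, Q (k + 1) = Q k \ Finset.univ.biUnion
        (fun i =>
          ((parts k i).filter fun v => ∀ u ∈ ext k i, G.Adj v u → id v ≤ id u) ∪
            misN G ((parts k i).filter fun v => ∀ u ∈ ext k i, G.Adj v u → id v ≤ id u)))
    (k : ℕ) :
    B k = (misIter G id k).1 ∧ Q k = (misIter G id k).2 := by
  induction k with
  | zero => exact ⟨hB0, hQ0⟩
  | succ k ih =>
    have hT := biUnion_filter_eq_misT G id (hunion k) (hsub' k) (hnbr k)
    rw [hBsucc, hQsucc, biUnion_union_misN, hT, ih.1, ih.2]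
    exact ⟨rfl, rfl⟩
end
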